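/- Decidability of MB+: the set of valid MB+-formulas is decidable, i.e., there is an algorithm which, given any MB+-formula A, decides whether A is valid. -/

import Mathlib

set_option maxHeartbeats 1000000

namespace MBQL

/-- The fixed finite set `J ⊆ [0,1]` of inner-product values, with `0, 1 ∈ J`. -/
structure MBParams where
  J : Set ℝ
  finite : J.Finite
  subI : J ⊆ Set.Icc (0:ℝ) 1
  zero_mem : (0:ℝ) ∈ J
  one_mem : (1:ℝ) ∈ J

/-- Formulas of **MB+**: generated from variables, `⊤`, `⊥` by `¬`, `∧` and
the modalities `□^=_α` (`α ∈ J`, `0 < α ≤ 1`), `□^o_α` (`α ∈ J`) and `□^c_0`. -/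
inductive MBPForm (Pm : MBParams) : Type
  | var : ℕ → MBPForm Pm
  | top : MBPForm Pm
  | bot : MBPForm Pm
  | neg : MBPForm Pm → MBPForm Pm
  | conj : MBPForm Pm → MBPForm Pm → MBPForm Pm
  | boxe : (α : ℝ) → α ∈ Pm.J → 0 < α → MBPForm Pm → MBPForm Pm
  | boxo : (α : ℝ) → α ∈ Pm.J → MBPForm Pm → MBPForm Pm
  | boxc0 : MBPForm Pm → MBPForm Pm

noncomputable instance {Pm : MBParams} : DecidableEq (MBPForm Pm) := Classical.decEq _

/-- Valuation of an MB+-formula, given worlds `S`, a relation `R` and a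
valuation `V` of the propositional variables. -/
def MBPForm.valR {Pm : MBParams} {S : Type} (R : S → S → ℝ) (V : ℕ → Set S) :
    MBPForm Pm → Set S
  | .var n => V n
  | .top => Set.univ
  | .bot => ∅
  | .neg A => (A.valR R V)ᶜ
  | .conj A B => A.valR R V ∩ B.valR R V
  | .boxe α _ _ A => {s | ∀ u, R s u = α → u ∈ A.valR R V}
  | .boxo α _ A => {s | ∀ u, α < R s u → u ∈ A.valR R V}
  | .boxc0 A => {s | ∀ u, u ∈ A.valR R V}

/-- An EQL-frame. -/
structure EQLFrame where
  S : Type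
  nonempty : Nonempty S
  R : S → S → ℝ
  mem_Icc : ∀ s t, R s t ∈ Set.Icc (0:ℝ) 1
  eq_one_iff : ∀ s t, (R s t = 1 ↔ s = t)
  symm : ∀ s t, R s t = R t s

/-- An MB-realization for the language of MB+. -/
structure MBPRealization (Pm : MBParams) where
  F : EQLFrame
  P : Set (Set F.S)
  univ_mem : Set.univ ∈ P
  empty_mem : ∅ ∈ P
  inter_mem : ∀ X ∈ P, ∀ Y ∈ P, X ∩ Y ∈ P
  compl_mem : ∀ X ∈ P, Xᶜ ∈ P
  boxe_mem : ∀ α ∈ Pm.J, 0 < α → ∀ X ∈ P, {s | ∀ u, F.R s u = α → u ∈ X} ∈ P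
  boxo_mem : ∀ α ∈ Pm.J, ∀ X ∈ P, {s | ∀ u, α < F.R s u → u ∈ X} ∈ P
  boxc0_mem : ∀ X ∈ P, {s | ∀ u, u ∈ X} ∈ P
  V : ℕ → Set F.S
  V_mem : ∀ n, V n ∈ P

/-- The extended valuation in an MB+-realization. -/
def MBPRealization.val {Pm : MBParams} (M : MBPRealization Pm) (A : MBPForm Pm) :
    Set M.F.S := A.valR M.F.R M.V

/-- Validity of an MB+-formula. -/
def MBPValid {Pm : MBParams} (A : MBPForm Pm) : Prop :=
  ∀ (M : MBPRealization Pm) (s : M.F.S), s ∈ M.val A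

/-- Bracket labels for nested-sequents of MB+: `[·]^=_α` (`0 < α ≤ 1`),
`[·]^o_α` (`α ≠ 1`) and `[·]^c_0`. -/
inductive PLab (Pm : MBParams) : Type
  | eq : (α : ℝ) → α ∈ Pm.J → 0 < α → PLab Pm
  | o : (α : ℝ) → α ∈ Pm.J → α ≠ 1 → PLab Pm
  | c0 : PLab Pm

mutual
/-- Nested-sequents of MB+. -/
inductive PNSeq (Pm : MBParams) : Type
  | node : Finset (MBPForm Pm) → Finset (MBPForm Pm) → PNSeqs Pm → PNSeq Pm
/-- A finite list of labelled child nested-sequents of MB+. -/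
inductive PNSeqs (Pm : MBParams) : Type
  | nil : PNSeqs Pm
  | cons : PLab Pm → PNSeq Pm → PNSeqs Pm → PNSeqs Pm
end

/-- The `i`-th labelled child. -/
def PNSeqs.get {Pm : MBParams} : PNSeqs Pm → ℕ → Option (PLab Pm × PNSeq Pm)
  | .nil, _ => none
  | .cons l t _, 0 => some (l, t)
  | .cons _ _ ts, n+1 => ts.get n

/-- `PSubAt t p u`: the subtree of `t` at the node address `p` is `u`. -/
inductive PSubAt {Pm : MBParams} : PNSeq Pm → List ℕ → PNSeq Pm → Prop
  | here (t : PNSeq Pm) : PSubAt t [] t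
  | there {Γ Δ : Finset (MBPForm Pm)} {ts : PNSeqs Pm} {i : ℕ} {l : PLab Pm}
      {u v : PNSeq Pm} {p : List ℕ} :
      PNSeqs.get ts i = some (l, u) → PSubAt u p v → PSubAt (.node Γ Δ ts) (i :: p) v

mutual
/-- Replace the sequent at the node with address `p` by `Γ' ⇒ Δ'`. -/
def PNSeq.setSeq {Pm : MBParams} :
    PNSeq Pm → List ℕ → Finset (MBPForm Pm) → Finset (MBPForm Pm) → PNSeq Pm
  | .node _ _ ts, [], Γ', Δ' => .node Γ' Δ' ts
  | .node Γ Δ ts, i :: p, Γ', Δ' => .node Γ Δ (PNSeqs.setSeqs ts i p Γ' Δ')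
def PNSeqs.setSeqs {Pm : MBParams} :
    PNSeqs Pm → ℕ → List ℕ → Finset (MBPForm Pm) → Finset (MBPForm Pm) → PNSeqs Pm
  | .nil, _, _, _, _ => .nil
  | .cons l t ts, 0, p, Γ', Δ' => .cons l (t.setSeq p Γ' Δ') ts
  | .cons l t ts, n+1, p, Γ', Δ' => .cons l t (PNSeqs.setSeqs ts n p Γ' Δ')
end

/-- Append a labelled child at the end of a children list. -/
def PNSeqs.snoc {Pm : MBParams} : PNSeqs Pm → PLab Pm → PNSeq Pm → PNSeqs Pm
  | .nil, l, u => .cons l u .nil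
  | .cons l' t ts, l, u => .cons l' t (ts.snoc l u)

mutual
/-- Add a new child `[u]_l` at the node with address `p`. -/
def PNSeq.addChild {Pm : MBParams} : PNSeq Pm → List ℕ → PLab Pm → PNSeq Pm → PNSeq Pm
  | .node Γ Δ ts, [], l, u => .node Γ Δ (ts.snoc l u)
  | .node Γ Δ ts, i :: p, l, u => .node Γ Δ (PNSeqs.addChilds ts i p l u)
def PNSeqs.addChilds {Pm : MBParams} :
    PNSeqs Pm → ℕ → List ℕ → PLab Pm → PNSeq Pm → PNSeqs Pm
  | .nil, _, _, _, _ => .nil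
  | .cons l' t ts, 0, p, l, u => .cons l' (t.addChild p l u) ts
  | .cons l' t ts, n+1, p, l, u => .cons l' t (PNSeqs.addChilds ts n p l u)
end

/-- `A ∨ B`. -/
def MBPForm.or {Pm : MBParams} (A B : MBPForm Pm) : MBPForm Pm :=
  .neg (.conj (.neg A) (.neg B))

/-- `A → B := ¬A ∨ B`. -/
def MBPForm.imp {Pm : MBParams} (A B : MBPForm Pm) : MBPForm Pm := (MBPForm.neg A).or B

/-- Conjunction of a list of formulas. -/
def pconjList {Pm : MBParams} : List (MBPForm Pm) → MBPForm Pm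
  | [] => .top
  | [A] => A
  | A :: B :: rest => .conj A (pconjList (B :: rest))

/-- Disjunction of a list of formulas. -/
def pdisjList {Pm : MBParams} : List (MBPForm Pm) → MBPForm Pm
  | [] => .bot
  | [A] => A
  | A :: B :: rest => (A).or (pdisjList (B :: rest))

/-- `⋀Γ → ⋁Δ`. -/
noncomputable def pseqForm {Pm : MBParams} (Γ Δ : Finset (MBPForm Pm)) : MBPForm Pm :=
  (pconjList Γ.toList).imp (pdisjList Δ.toList)

/-- The box corresponding to a bracket label of MB+. -/
def PLab.box {Pm : MBParams} : PLab Pm → MBPForm Pm → MBPForm Pm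
  | .eq α h h0, A => .boxe α h h0 A
  | .o α h _, A => .boxo α h A
  | .c0, A => .boxc0 A

mutual
/-- The interpretation `τ` of an MB+ nested-sequent as an MB+-formula. -/
noncomputable def PNSeq.tau {Pm : MBParams} : PNSeq Pm → MBPForm Pm
  | .node Γ Δ ts => PNSeqs.tauAux (pseqForm Γ Δ) ts
noncomputable def PNSeqs.tauAux {Pm : MBParams} : MBPForm Pm → PNSeqs Pm → MBPForm Pm
  | A, .nil => A
  | A, .cons l t ts => PNSeqs.tauAux (A.or (l.box t.tau)) ts
end

/-- The condition imposed on `R(E(n₁), E(n₂))` by a bracket label of MB+. -/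
def PLabCond {Pm : MBParams} (l : PLab Pm) (r : ℝ) : Prop :=
  match l with
  | .eq α _ _ => r = α
  | .o α _ _ => α < r
  | .c0 => True

/-- `E` is an embedding of the MB+ nested-sequent `t` into `M`. -/
def PIsEmb {Pm : MBParams} (M : MBPRealization Pm) (t : PNSeq Pm)
    (E : List ℕ → M.F.S) : Prop :=
  ∀ p Γ Δ ts i l u, PSubAt t p (.node Γ Δ ts) → PNSeqs.get ts i = some (l, u) →
    PLabCond l (M.F.R (E p) (E (p ++ [i])))

/-- The MB+ nested-sequent `t` is false in `M` under `E`. -/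
def PFalseUnder {Pm : MBParams} (M : MBPRealization Pm) (t : PNSeq Pm)
    (E : List ℕ → M.F.S) : Prop :=
  ∀ p Γ Δ ts, PSubAt t p (.node Γ Δ ts) →
    (∀ A ∈ Γ, E p ∈ M.val A) ∧ (∀ A ∈ Δ, E p ∉ M.val A)

/-- Validity of an MB+ nested-sequent. -/
def PNSValid {Pm : MBParams} (t : PNSeq Pm) : Prop :=
  ∀ (M : MBPRealization Pm) (E : List ℕ → M.F.S), PIsEmb M t E → ¬ PFalseUnder M t E

/-- Descriptors of the left-rule boxes `□^=_α`, `□^o_α` of MB+. -/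
inductive PBox (Pm : MBParams) : Type
  | e : (α : ℝ) → α ∈ Pm.J → 0 < α → PBox Pm
  | o : (α : ℝ) → α ∈ Pm.J → PBox Pm

/-- The box formula corresponding to a box descriptor. -/
def PBox.box {Pm : MBParams} : PBox Pm → MBPForm Pm → MBPForm Pm
  | .e α h h0, A => .boxe α h h0 A
  | .o α h, A => .boxo α h A

/-- Side condition of the rules (□L), (□L sym) of NSMB+:
`(d = d' = "=" and α = β)`, or `(d = d' = o and α < β)`, or
`(d = o, d' = "=" and α < β)`. -/
def PC1 {Pm : MBParams} : PBox Pm → PLab Pm → Prop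
  | .e α _ _, .eq β _ _ => α = β
  | .o α _, .o β _ _ => α < β
  | .o α _, .eq β _ _ => α < β
  | _, _ => False

/-- Side condition of the rule (□L self) of NSMB+:
`(d = "=" and α = 1)` or `(d = o and α ≠ 1)`. -/
def PC2 {Pm : MBParams} : PBox Pm → Prop
  | .e α _ _ => α = 1
  | .o α _ => α ≠ 1

/-- Provability in the nested-sequent calculus **NSMB+**; the boolean records
whether (cut) may be used. -/
inductive PProvable {Pm : MBParams} : Bool → PNSeq Pm → Prop
  /-- axiom `‖A, Γ ⇒ Δ, A, T‖` -/
  | axId {cut : Bool} {t : PNSeq Pm} {p Γ Δ ts A} :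
      PSubAt t p (.node Γ Δ ts) → A ∈ Γ → A ∈ Δ → PProvable cut t
  /-- axiom `‖Γ ⇒ Δ, ⊤, T‖` -/
  | axTop {cut : Bool} {t : PNSeq Pm} {p Γ Δ ts} :
      PSubAt t p (.node Γ Δ ts) → MBPForm.top ∈ Δ → PProvable cut t
  /-- axiom `‖⊥, Γ ⇒ Δ, T‖` -/
  | axBot {cut : Bool} {t : PNSeq Pm} {p Γ Δ ts} :
      PSubAt t p (.node Γ Δ ts) → MBPForm.bot ∈ Γ → PProvable cut t
  /-- axiom `‖Γ ⇒ Δ, □^o_1 A, T‖` -/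
  | axBoxO1 {cut : Bool} {t : PNSeq Pm} {p Γ Δ ts A} :
      PSubAt t p (.node Γ Δ ts) → MBPForm.boxo 1 Pm.one_mem A ∈ Δ → PProvable cut t
  /-- rule (cut) -/
  | cutR {t : PNSeq Pm} {p Γ Δ ts A} :
      PSubAt t p (.node Γ Δ ts) →
      PProvable true (t.setSeq p Γ (insert A Δ)) →
      PProvable true (t.setSeq p (insert A Γ) Δ) →
      PProvable true t
  /-- rule (wL) -/
  | wL {cut : Bool} {t : PNSeq Pm} {p Γ Δ ts A} :
      PSubAt t p (.node Γ Δ ts) → PProvable cut t →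
      PProvable cut (t.setSeq p (insert A Γ) Δ)
  /-- rule (wR) -/
  | wR {cut : Bool} {t : PNSeq Pm} {p Γ Δ ts A} :
      PSubAt t p (.node Γ Δ ts) → PProvable cut t →
      PProvable cut (t.setSeq p Γ (insert A Δ))
  /-- rule (¬L) -/
  | negL {cut : Bool} {t : PNSeq Pm} {p Γ Δ ts A} :
      PSubAt t p (.node Γ Δ ts) →
      PProvable cut (t.setSeq p Γ (insert A Δ)) →
      PProvable cut (t.setSeq p (insert (MBPForm.neg A) Γ) Δ)
  /-- rule (¬R) -/
  | negR {cut : Bool} {t : PNSeq Pm} {p Γ Δ ts A} :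
      PSubAt t p (.node Γ Δ ts) →
      PProvable cut (t.setSeq p (insert A Γ) Δ) →
      PProvable cut (t.setSeq p Γ (insert (MBPForm.neg A) Δ))
  /-- rule (∧L) -/
  | andL {cut : Bool} {t : PNSeq Pm} {p Γ Δ ts A B} :
      PSubAt t p (.node Γ Δ ts) →
      PProvable cut (t.setSeq p (insert A (insert B Γ)) Δ) →
      PProvable cut (t.setSeq p (insert (MBPForm.conj A B) Γ) Δ)
  /-- rule (∧R) -/
  | andR {cut : Bool} {t : PNSeq Pm} {p Γ Δ ts A B} :
      PSubAt t p (.node Γ Δ ts) →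
      PProvable cut (t.setSeq p Γ (insert A Δ)) →
      PProvable cut (t.setSeq p Γ (insert B Δ)) →
      PProvable cut (t.setSeq p Γ (insert (MBPForm.conj A B) Δ))
  /-- rule (□L) of NSMB+ -/
  | boxL {cut : Bool} {t : PNSeq Pm} {p Γ Δ ts i l u Γ' Δ' ts' A} {b : PBox Pm} :
      PSubAt t p (.node Γ Δ ts) → PNSeqs.get ts i = some (l, u) →
      PSubAt t (p ++ [i]) (.node Γ' Δ' ts') →
      PC1 b l →
      PProvable cut (t.setSeq (p ++ [i]) (insert A Γ') Δ') →
      PProvable cut (t.setSeq p (insert (b.box A) Γ) Δ)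
  /-- rule (□L sym) of NSMB+ -/
  | boxLsym {cut : Bool} {t : PNSeq Pm} {p Γ Δ ts i l u Γ' Δ' ts' A} {b : PBox Pm} :
      PSubAt t p (.node Γ Δ ts) → PNSeqs.get ts i = some (l, u) →
      PSubAt t (p ++ [i]) (.node Γ' Δ' ts') →
      PC1 b l →
      PProvable cut (t.setSeq p (insert A Γ) Δ) →
      PProvable cut (t.setSeq (p ++ [i]) (insert (b.box A) Γ') Δ')
  /-- rule (□L self) of NSMB+ -/
  | boxLself {cut : Bool} {t : PNSeq Pm} {p Γ Δ ts A} {b : PBox Pm} :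
      PSubAt t p (.node Γ Δ ts) → PC2 b →
      PProvable cut (t.setSeq p (insert A Γ) Δ) →
      PProvable cut (t.setSeq p (insert (b.box A) Γ) Δ)
  /-- rule (□^c_0) -/
  | boxC0 {cut : Bool} {t : PNSeq Pm} {p Γ Δ ts q Γ'' Δ'' ts'' A} :
      PSubAt t p (.node Γ Δ ts) → PSubAt t q (.node Γ'' Δ'' ts'') →
      PProvable cut (t.setSeq p (insert A Γ) Δ) →
      PProvable cut (t.setSeq q (insert (MBPForm.boxc0 A) Γ'') Δ'')
  /-- rule (□R) -/
  | boxR {cut : Bool} {t : PNSeq Pm} {p Γ Δ ts A} {l : PLab Pm} :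
      PSubAt t p (.node Γ Δ ts) →
      PProvable cut (t.addChild p l (.node ∅ {A} .nil)) →
      PProvable cut (t.setSeq p Γ (insert (l.box A) Δ))
  /-- rule (= R self) -/
  | eqRself {cut : Bool} {t : PNSeq Pm} {p Γ Δ ts A} :
      PSubAt t p (.node Γ Δ ts) →
      PProvable cut (t.setSeq p Γ (insert A Δ)) →
      PProvable cut (t.setSeq p Γ (insert (MBPForm.boxe 1 Pm.one_mem one_pos A) Δ))


/-- Encoding of a real number that is (the cast of) a rational as a natural
number (`0` for other reals); on rationals this is the standard injective
encoding of `ℚ`. -/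
noncomputable def encR (α : ℝ) : ℕ :=
  letI := Classical.propDecidable
  if h : ∃ q : ℚ, (q : ℝ) = α then Encodable.encode (Classical.choose h) else 0

/-- An injective Gödel numbering of the formulas of MB+ (provided all
elements of `J` are rational). -/
noncomputable def encPForm {Pm : MBParams} : MBPForm Pm → ℕ
  | .var n => Nat.pair 0 n
  | .top => Nat.pair 1 0
  | .bot => Nat.pair 2 0
  | .neg A => Nat.pair 3 (encPForm A)
  | .conj A B => Nat.pair 4 (Nat.pair (encPForm A) (encPForm B))
  | .boxe α _ _ A => Nat.pair 5 (Nat.pair (encR α) (encPForm A))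
  | .boxo α _ A => Nat.pair 6 (Nat.pair (encR α) (encPForm A))
  | .boxc0 A => Nat.pair 7 (encPForm A)

/-! ### Helper material for the proof -/

section helpers

/-- The semantic hit relation of the modality with tag `t` and real code `e`. -/
def HR (J : Set ℝ) (t e : ℕ) (ρ : ℝ) : Prop :=
  (t = 5 ∧ ∃ α ∈ J, 0 < α ∧ encR α = e ∧ ρ = α) ∨ (t = 6 ∧ ∃ α ∈ J, encR α = e ∧ α < ρ)

/-- Two types are compatible along an edge of color `c`. -/
def Compat (H : ℕ → ℕ → ℕ → Prop) (n x c y : ℕ) : Prop :=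
  ∀ i < n + 1, H i.unpair.1 i.unpair.2.unpair.1 c →
    (x.testBit i = true → y.testBit i.unpair.2.unpair.2 = true) ∧
    (y.testBit i = true → x.testBit i.unpair.2.unpair.2 = true)

theorem Compat.symm {H : ℕ → ℕ → ℕ → Prop} {n x c y : ℕ} (h : Compat H n x c y) :
    Compat H n y c x := fun i hi hh => (h i hi hh).symm

/-- Local condition on formula code `i` at the type `x`. -/
def Loc (K : ℕ) (H : ℕ → ℕ → ℕ → Prop) (n T x i : ℕ) : Prop :=
  (i.unpair.1 = 1 → x.testBit i = true) ∧
  (i.unpair.1 = 2 → ¬ x.testBit i = true) ∧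
  (i.unpair.1 = 3 → (x.testBit i = true ↔ ¬ x.testBit i.unpair.2 = true)) ∧
  (i.unpair.1 = 4 → (x.testBit i = true ↔
    (x.testBit i.unpair.2.unpair.1 = true ∧ x.testBit i.unpair.2.unpair.2 = true))) ∧
  ((i.unpair.1 = 5 ∨ i.unpair.1 = 6) →
    ((¬ x.testBit i = true →
      ((∃ c < K, H i.unpair.1 i.unpair.2.unpair.1 c ∧ ∃ y < 2 ^ (n + 1),
          T.testBit y = true ∧ ¬ y.testBit i.unpair.2.unpair.2 = true ∧ Compat H n x c y) ∨
        (H i.unpair.1 i.unpair.2.unpair.1 K ∧ ¬ x.testBit i.unpair.2.unpair.2 = true))) ∧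
     (x.testBit i = true → H i.unpair.1 i.unpair.2.unpair.1 K →
        x.testBit i.unpair.2.unpair.2 = true))) ∧
  (i.unpair.1 = 7 → (x.testBit i = true ↔
    ∀ y < 2 ^ (n + 1), T.testBit y = true → y.testBit i.unpair.2 = true))

/-- `T` codes a set of types refuting the formula with code `n`. -/
def Good (K : ℕ) (H : ℕ → ℕ → ℕ → Prop) (n T : ℕ) : Prop :=
  (∃ x < 2 ^ (n + 1), T.testBit x = true ∧ ¬ x.testBit n = true) ∧
  ∀ x < 2 ^ (n + 1), T.testBit x = true → ∀ i < n + 1, Loc K H n T x i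

/-! #### Primitive recursiveness -/

theorem exB {α : Type*} [Primcodable α] {f : α → ℕ} {p : α → ℕ → Prop} (hf : Primrec f)
    (hp : PrimrecPred fun q : α × ℕ => p q.1 q.2) : PrimrecPred fun a => ∃ x < f a, p a x := by
  have h : PrimrecRel (fun (x : ℕ) (a : α) => p a x) := hp.comp (Primrec.snd.pair Primrec.fst)
  exact (h.exists_mem_list.comp (Primrec.list_range.comp hf) Primrec.id).of_eq (by simp)

theorem faB {α : Type*} [Primcodable α] {f : α → ℕ} {p : α → ℕ → Prop} (hf : Primrec f)
    (hp : PrimrecPred fun q : α × ℕ => p q.1 q.2) : PrimrecPred fun a => ∀ x < f a, p a x := by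
  have h : PrimrecRel (fun (x : ℕ) (a : α) => p a x) := hp.comp (Primrec.snd.pair Primrec.fst)
  exact (h.forall_mem_list.comp (Primrec.list_range.comp hf) Primrec.id).of_eq (by simp)

theorem impP {α : Type*} [Primcodable α] {p q : α → Prop} (hp : PrimrecPred p)
    (hq : PrimrecPred q) : PrimrecPred fun a => p a → q a :=
  (hp.not.or hq).of_eq fun a => by tauto

theorem iffP {α : Type*} [Primcodable α] {p q : α → Prop} (hp : PrimrecPred p)
    (hq : PrimrecPred q) : PrimrecPred fun a => (p a ↔ q a) :=
  ((impP hp hq).and (impP hq hp)).of_eq fun a => by tauto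

theorem powP {α : Type*} [Primcodable α] {f : α → ℕ} (hf : Primrec f) :
    Primrec fun a => 2 ^ f a :=
  (Primrec₂.unpaired'.1 Nat.Primrec.pow).comp (Primrec.const 2) hf

theorem bitP {α : Type*} [Primcodable α] {f g : α → ℕ} (hf : Primrec f) (hg : Primrec g) :
    PrimrecPred fun a => (f a).testBit (g a) = true := by
  have h : PrimrecPred fun a => (f a / 2 ^ g a) % 2 = 1 :=
    Primrec.eq.comp (Primrec.nat_mod.comp (Primrec.nat_div.comp hf (powP hg)) (Primrec.const 2))
      (Primrec.const 1)
  exact h.of_eq fun a => by rw [Nat.testBit_eq_decide_div_mod_eq]; simp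

theorem u1 {α : Type*} [Primcodable α] {f : α → ℕ} (hf : Primrec f) :
    Primrec fun a => (f a).unpair.1 := Primrec.fst.comp (Primrec.unpair.comp hf)

theorem u2 {α : Type*} [Primcodable α] {f : α → ℕ} (hf : Primrec f) :
    Primrec fun a => (f a).unpair.2 := Primrec.snd.comp (Primrec.unpair.comp hf)

theorem eqP {α : Type*} [Primcodable α] {f : α → ℕ} (hf : Primrec f) (k : ℕ) :
    PrimrecPred fun a => f a = k := Primrec.eq.comp hf (Primrec.const k)

theorem finP {α : Type*} [Primcodable α] {s : Set α} (hs : s.Finite) :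
    PrimrecPred fun a => a ∈ s := by
  have h : PrimrecRel (fun (x : α) (a : α) => x = a) := Primrec.eq
  refine (h.exists_mem_list.comp (Primrec.const hs.toFinset.toList) Primrec.id).of_eq fun a => ?_
  simp

theorem hitP {H : ℕ → ℕ → ℕ → Prop}
    (hH : PrimrecPred fun p : ℕ × ℕ × ℕ => H p.1 p.2.1 p.2.2)
    {α : Type*} [Primcodable α] {f g h : α → ℕ} (hf : Primrec f) (hg : Primrec g)
    (hh : Primrec h) : PrimrecPred fun a => H (f a) (g a) (h a) :=
  hH.comp (hf.pair (hg.pair hh))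

theorem compatP {H : ℕ → ℕ → ℕ → Prop}
    (hH : PrimrecPred fun p : ℕ × ℕ × ℕ => H p.1 p.2.1 p.2.2)
    {α : Type*} [Primcodable α] {n x c y : α → ℕ} (hn : Primrec n) (hx : Primrec x)
    (hc : Primrec c) (hy : Primrec y) :
    PrimrecPred fun a => Compat H (n a) (x a) (c a) (y a) := by
  have F : Primrec (fun q : α × ℕ => q.1) := Primrec.fst
  have hi : Primrec (fun q : α × ℕ => q.2) := Primrec.snd
  refine faB (Primrec.succ.comp hn) ?_
  refine impP (hitP hH (u1 hi) (u1 (u2 hi)) (hc.comp F)) (PrimrecPred.and ?_ ?_)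
  · exact impP (bitP (hx.comp F) hi) (bitP (hy.comp F) (u2 (u2 hi)))
  · exact impP (bitP (hy.comp F) hi) (bitP (hx.comp F) (u2 (u2 hi)))

theorem locP {H : ℕ → ℕ → ℕ → Prop}
    (hH : PrimrecPred fun p : ℕ × ℕ × ℕ => H p.1 p.2.1 p.2.2)
    (K : ℕ) {α : Type*} [Primcodable α] {n T x i : α → ℕ} (hn : Primrec n)
    (hT : Primrec T) (hx : Primrec x) (hi : Primrec i) :
    PrimrecPred fun a => Loc K H (n a) (T a) (x a) (i a) := by
  have F : Primrec (fun q : α × ℕ => q.1) := Primrec.fst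
  have S : Primrec (fun q : α × ℕ => q.2) := Primrec.snd
  have FF : Primrec (fun q : (α × ℕ) × ℕ => q.1.1) := Primrec.fst.comp Primrec.fst
  have FS : Primrec (fun q : (α × ℕ) × ℕ => q.1.2) := Primrec.snd.comp Primrec.fst
  have SS : Primrec (fun q : (α × ℕ) × ℕ => q.2) := Primrec.snd
  have t := u1 hi
  have bx := bitP hx hi
  have b2 := bitP hx (u2 (u2 hi))
  have hK := hitP hH (u1 hi) (u1 (u2 hi)) (Primrec.const K)
  refine PrimrecPred.and (impP (eqP t 1) bx) ?_
  refine PrimrecPred.and (impP (eqP t 2) bx.not) ?_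
  refine PrimrecPred.and (impP (eqP t 3) (iffP bx (bitP hx (u2 hi)).not)) ?_
  refine PrimrecPred.and (impP (eqP t 4) (iffP bx ((bitP hx (u1 (u2 hi))).and b2))) ?_
  refine PrimrecPred.and (impP ((eqP t 5).or (eqP t 6)) (PrimrecPred.and (impP bx.not
    (PrimrecPred.or ?_ (hK.and b2.not))) (impP bx (impP hK b2)))) ?_
  · refine exB (Primrec.const K) (PrimrecPred.and
      (hitP hH ((u1 hi).comp F) ((u1 (u2 hi)).comp F) S) ?_)
    refine exB (powP (Primrec.succ.comp (hn.comp F))) ?_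
    refine PrimrecPred.and (bitP (hT.comp FF) SS) (PrimrecPred.and
      (bitP SS ((u2 (u2 hi)).comp FF)).not ?_)
    exact compatP hH (hn.comp FF) (hx.comp FF) FS SS
  · refine impP (eqP t 7) (iffP bx (faB (powP (Primrec.succ.comp hn)) ?_))
    exact impP (bitP (hT.comp F) S) (bitP S ((u2 hi).comp F))

theorem goodP {H : ℕ → ℕ → ℕ → Prop}
    (hH : PrimrecPred fun p : ℕ × ℕ × ℕ => H p.1 p.2.1 p.2.2)
    (K : ℕ) {α : Type*} [Primcodable α] {n T : α → ℕ} (hn : Primrec n)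
    (hT : Primrec T) : PrimrecPred fun a => Good K H (n a) (T a) := by
  have F : Primrec (fun q : α × ℕ => q.1) := Primrec.fst
  have S : Primrec (fun q : α × ℕ => q.2) := Primrec.snd
  have FF : Primrec (fun q : (α × ℕ) × ℕ => q.1.1) := Primrec.fst.comp Primrec.fst
  have FS : Primrec (fun q : (α × ℕ) × ℕ => q.1.2) := Primrec.snd.comp Primrec.fst
  have SS : Primrec (fun q : (α × ℕ) × ℕ => q.2) := Primrec.snd
  refine PrimrecPred.and (exB (powP (Primrec.succ.comp hn)) ?_)
    (faB (powP (Primrec.succ.comp hn)) ?_)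
  · exact (bitP (hT.comp F) S).and (bitP S (hn.comp F)).not
  · refine impP (bitP (hT.comp F) S) (faB (Primrec.succ.comp (hn.comp F)) ?_)
    exact locP hH K (hn.comp FF) (hT.comp FF) FS SS

theorem searchP {H : ℕ → ℕ → ℕ → Prop}
    (hH : PrimrecPred fun p : ℕ × ℕ × ℕ => H p.1 p.2.1 p.2.2)
    (K : ℕ) :
    PrimrecPred fun n : ℕ => ¬ ∃ T < 2 ^ (2 ^ (n + 1)), Good K H n T :=
  PrimrecPred.not (exB (powP (powP Primrec.succ)) (goodP hH K Primrec.fst Primrec.snd))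

/-! #### Semantics -/

theorem encR_inj {α β : ℝ} (hα : ∃ q : ℚ, (q : ℝ) = α) (hβ : ∃ q : ℚ, (q : ℝ) = β)
    (h : encR α = encR β) : α = β := by
  unfold encR at h
  rw [dif_pos hα, dif_pos hβ] at h
  have := Encodable.encode_injective h
  rw [← Classical.choose_spec hα, ← Classical.choose_spec hβ, this]

theorem HR5 {J : Set ℝ} (hQ : ∀ α ∈ J, ∃ q : ℚ, (q : ℝ) = α) {α : ℝ} (h : α ∈ J) (h0 : 0 < α)
    (ρ : ℝ) : HR J 5 (encR α) ρ ↔ ρ = α := by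
  constructor
  · rintro (⟨_, β, hβ, _, he, rfl⟩ | ⟨h6, _⟩)
    · exact encR_inj (hQ _ hβ) (hQ _ h) he
    · omega
  · rintro rfl
    exact Or.inl ⟨rfl, ρ, h, h0, rfl, rfl⟩

theorem HR6 {J : Set ℝ} (hQ : ∀ α ∈ J, ∃ q : ℚ, (q : ℝ) = α) {α : ℝ} (h : α ∈ J)
    (ρ : ℝ) : HR J 6 (encR α) ρ ↔ α < ρ := by
  constructor
  · rintro (⟨h6, _⟩ | ⟨_, β, hβ, he, hlt⟩)
    · omega
    · rwa [← encR_inj (hQ _ hβ) (hQ _ h) he]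
  · intro hlt
    exact Or.inr ⟨rfl, α, h, rfl, hlt⟩

/-- Truth of (arbitrary) codes. -/
def tr (J : Set ℝ) {S : Type} (R : S → S → ℝ) (V : ℕ → Set S) (i : ℕ) (s : S) : Prop :=
  if h : i.unpair.1 = 0 then s ∈ V i.unpair.2 else
    have h1 : i.unpair.2 < i := by
      have := Nat.add_le_pair i.unpair.1 i.unpair.2
      rw [Nat.pair_unpair] at this
      omega
    have h2 : i.unpair.2.unpair.1 < i := lt_of_le_of_lt (Nat.unpair_left_le _) h1
    have h3 : i.unpair.2.unpair.2 < i := lt_of_le_of_lt (Nat.unpair_right_le _) h1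
    i.unpair.1 = 1 ∨ (i.unpair.1 = 3 ∧ ¬ tr J R V i.unpair.2 s) ∨
    (i.unpair.1 = 4 ∧ tr J R V i.unpair.2.unpair.1 s ∧ tr J R V i.unpair.2.unpair.2 s) ∨
    ((i.unpair.1 = 5 ∨ i.unpair.1 = 6) ∧
      ∀ u, HR J i.unpair.1 i.unpair.2.unpair.1 (R s u) → tr J R V i.unpair.2.unpair.2 u) ∨
    (i.unpair.1 = 7 ∧ ∀ u, tr J R V i.unpair.2 u)
termination_by i

theorem tr_enc {Pm : MBParams} (hQ : ∀ α ∈ Pm.J, ∃ q : ℚ, (q : ℝ) = α) {S : Type}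
    (R : S → S → ℝ) (V : ℕ → Set S) (A : MBPForm Pm) :
    ∀ s, tr Pm.J R V (encPForm A) s ↔ s ∈ A.valR R V := by
  induction A with
  | var n => intro s; rw [tr]; simp [encPForm, MBPForm.valR]
  | top => intro s; rw [tr]; simp [encPForm, MBPForm.valR]
  | bot => intro s; rw [tr]; simp [encPForm, MBPForm.valR]
  | neg A ih => intro s; rw [tr]; simp [encPForm, MBPForm.valR, ih]
  | conj A B ihA ihB => intro s; rw [tr]; simp [encPForm, MBPForm.valR, ihA, ihB]
  | boxe α h h0 A ih =>
    intro s; rw [tr]; simp [encPForm, MBPForm.valR, ih, HR5 hQ h h0]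
  | boxo α h A ih =>
    intro s; rw [tr]; simp [encPForm, MBPForm.valR, ih, HR6 hQ h]
  | boxc0 A ih => intro s; rw [tr]; simp [encPForm, MBPForm.valR, ih]

/-- Finitely many representative colors. -/
theorem exists_colors (Pm : MBParams) : ∃ (K : ℕ) (r : ℕ → ℝ), 0 < K ∧ r 0 = 0 ∧ r K = 1 ∧
    (∀ c < K, r c ∈ Set.Ico (0:ℝ) 1) ∧
    ∀ ρ ∈ Set.Ico (0:ℝ) 1, ∃ c < K, ∀ t e, HR Pm.J t e ρ ↔ HR Pm.J t e (r c) := by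
  classical
  let F : ℝ → Set ℝ × Set ℝ := fun ρ => ({α ∈ Pm.J | ρ = α}, {α ∈ Pm.J | α < ρ})
  have hfin : (F '' Set.Ico (0:ℝ) 1).Finite := by
    refine (Pm.finite.powerset.prod Pm.finite.powerset).subset ?_
    rintro _ ⟨ρ, _, rfl⟩
    exact ⟨fun x hx => hx.1, fun x hx => hx.1⟩
  let l : List ℝ := 0 :: hfin.toFinset.toList.map (Function.invFunOn F (Set.Ico (0:ℝ) 1))
  have hl : ∀ x ∈ l, x ∈ Set.Ico (0:ℝ) 1 := by
    intro x hx
    simp only [l, List.mem_cons, List.mem_map, Finset.mem_toList, Set.Finite.mem_toFinset] at hx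
    rcases hx with rfl | ⟨a, ha, rfl⟩
    · simp
    · exact Function.invFunOn_mem ha
  refine ⟨l.length, fun c => l.getD c 1, by simp [l], by simp [l], by simp, ?_, ?_⟩
  · intro c hc
    simp only [List.getD_eq_getElem _ _ hc]
    exact hl _ (List.getElem_mem hc)
  · intro ρ hρ
    have hm : F ρ ∈ F '' Set.Ico (0:ℝ) 1 := ⟨ρ, hρ, rfl⟩
    have hin : Function.invFunOn F (Set.Ico (0:ℝ) 1) (F ρ) ∈ l := by
      refine List.mem_cons_of_mem _ (List.mem_map_of_mem ?_)
      simpa using hm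
    have heq : F (Function.invFunOn F (Set.Ico (0:ℝ) 1) (F ρ)) = F ρ := Function.invFunOn_eq hm
    obtain ⟨c, hc, hcc⟩ := List.getElem_of_mem hin
    refine ⟨c, hc, fun t e => ?_⟩
    simp only [List.getD_eq_getElem _ _ hc, hcc]
    generalize Function.invFunOn F (Set.Ico (0:ℝ) 1) (F ρ) = σ at heq
    have e1 : ∀ α ∈ Pm.J, (σ = α ↔ ρ = α) := by
      intro α hα
      have := Set.ext_iff.1 (congrArg Prod.fst heq) α
      simpa [F, hα] using this
    have e2 : ∀ α ∈ Pm.J, (α < σ ↔ α < ρ) := by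
      intro α hα
      have := Set.ext_iff.1 (congrArg Prod.snd heq) α
      simpa [F, hα] using this
    unfold HR
    constructor
    · rintro (⟨h, α, hα, h0, he, hh⟩ | ⟨h, α, hα, he, hh⟩)
      · exact Or.inl ⟨h, α, hα, h0, he, (e1 α hα).2 hh⟩
      · exact Or.inr ⟨h, α, hα, he, (e2 α hα).2 hh⟩
    · rintro (⟨h, α, hα, h0, he, hh⟩ | ⟨h, α, hα, he, hh⟩)
      · exact Or.inl ⟨h, α, hα, h0, he, (e1 α hα).1 hh⟩
      · exact Or.inr ⟨h, α, hα, he, (e2 α hα).1 hh⟩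

/-- A countermodel yields a good set of types. -/
theorem good_of_model {Pm : MBParams} (K : ℕ) (r : ℕ → ℝ) (hrK : r K = 1)
    (hcov : ∀ ρ ∈ Set.Ico (0:ℝ) 1, ∃ c < K, ∀ t e, HR Pm.J t e ρ ↔ HR Pm.J t e (r c))
    (M : EQLFrame) (V : ℕ → Set M.S) (n : ℕ) (s0 : M.S) (h0 : ¬ tr Pm.J M.R V n s0) :
    ∃ T < 2 ^ (2 ^ (n + 1)), Good K (fun t e c => c ≤ K ∧ HR Pm.J t e (r c)) n T := by
  classical
  let X : M.S → ℕ := fun s => Nat.ofBits (fun i : Fin (n + 1) => decide (tr Pm.J M.R V i s))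
  have hXlt : ∀ s, X s < 2 ^ (n + 1) := fun s => Nat.ofBits_lt_two_pow _
  have hX : ∀ s, ∀ i < n + 1, ((X s).testBit i = true ↔ tr Pm.J M.R V i s) := by
    intro s i hi
    simp [X, Nat.testBit_ofBits_lt _ i hi]
  let T : ℕ := Nat.ofBits (fun x : Fin (2 ^ (n + 1)) => decide (∃ s, X s = x))
  have hT : ∀ x < 2 ^ (n + 1), (T.testBit x = true ↔ ∃ s, X s = x) := by
    intro x hx
    simp [T, Nat.testBit_ofBits_lt _ x hx]
  have hTX : ∀ s, T.testBit (X s) = true := fun s => (hT _ (hXlt s)).2 ⟨s, rfl⟩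
  refine ⟨T, Nat.ofBits_lt_two_pow _, ⟨X s0, hXlt s0, hTX s0, ?_⟩, ?_⟩
  · rw [hX _ _ (Nat.lt_succ_self n)]; exact h0
  intro x hx hxT i hi
  obtain ⟨s, rfl⟩ := (hT x hx).1 hxT
  have i1 : i.unpair.2 < n + 1 := lt_of_le_of_lt (Nat.unpair_right_le _) hi
  have i2 : i.unpair.2.unpair.1 < n + 1 := lt_of_le_of_lt (Nat.unpair_left_le _) i1
  have i3 : i.unpair.2.unpair.2 < n + 1 := lt_of_le_of_lt (Nat.unpair_right_le _) i1
  have hself : M.R s s = 1 := (M.eq_one_iff s s).2 rfl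
  refine ⟨?_, ?_, ?_, ?_, ?_, ?_⟩
  · intro h; rw [hX s i hi, tr]; simp [h]
  · intro h; rw [hX s i hi, tr]; simp [h]
  · intro h; rw [hX s i hi, hX s _ i1, tr]; simp [h]
  · intro h; rw [hX s i hi, hX s _ i2, hX s _ i3, tr]; simp [h]
  · intro h
    have key : ∀ s j, j < n + 1 → (j.unpair.1 = 5 ∨ j.unpair.1 = 6) → ((X s).testBit j = true ↔
        ∀ u, HR Pm.J j.unpair.1 j.unpair.2.unpair.1 (M.R s u) →
          (X u).testBit j.unpair.2.unpair.2 = true) := by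
      intro s j hj h
      have j3 : j.unpair.2.unpair.2 < n + 1 :=
        lt_of_le_of_lt (Nat.unpair_right_le _) (lt_of_le_of_lt (Nat.unpair_right_le _) hj)
      simp only [hX _ _ j3]
      rw [hX s j hj, tr]
      rcases h with h | h <;> simp [h]
    refine ⟨?_, ?_⟩
    · intro hb
      rw [key s i hi h] at hb
      push Not at hb
      obtain ⟨u, hu, hub⟩ := hb
      by_cases hsu : s = u
      · subst hsu
        right
        rw [hself] at hu
        exact ⟨⟨le_rfl, by rw [hrK]; exact hu⟩, by simpa using hub⟩
      · left
        have hne : M.R s u ≠ 1 := fun h => hsu ((M.eq_one_iff s u).1 h)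
        have hI := M.mem_Icc s u
        obtain ⟨c, hc, hcc⟩ := hcov (M.R s u) ⟨hI.1, lt_of_le_of_ne hI.2 hne⟩
        refine ⟨c, hc, ⟨hc.le, (hcc _ _).1 hu⟩, X u, hXlt u, hTX u, by simpa using hub, ?_⟩
        rintro j hj ⟨_, hh⟩
        have ht : j.unpair.1 = 5 ∨ j.unpair.1 = 6 := by
          rcases hh with ⟨h, _⟩ | ⟨h, _⟩
          · exact Or.inl h
          · exact Or.inr h
        rw [← hcc] at hh
        refine ⟨fun hb => (key s j hj ht).1 hb u hh, fun hb => (key u j hj ht).1 hb s ?_⟩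
        rw [M.symm u s]; exact hh
    · rintro hb ⟨_, hh⟩
      refine (key s i hi h).1 hb s ?_
      rw [hself, ← hrK]; exact hh
  · intro h
    rw [hX s i hi, tr]
    simp only [h]
    simp only [show ¬ (7:ℕ) = 0 by decide, dite_false, show ¬ (7:ℕ) = 1 by decide,
      show ¬ (7:ℕ) = 3 by decide, show ¬ (7:ℕ) = 4 by decide, show ¬ (7:ℕ) = 5 by decide,
      show ¬ (7:ℕ) = 6 by decide, false_and, false_or, true_and]
    constructor
    · intro hu y hy hyT
      obtain ⟨u, rfl⟩ := (hT y hy).1 hyT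
      exact (hX u _ i1).2 (hu u)
    · intro hall u
      exact (hX u _ i1).1 (hall _ (hXlt u) (hTX u))

open Classical in
/-- The similarity relation of the finite countermodel. -/
noncomputable def Rm (H : ℕ → ℕ → ℕ → Prop) (n : ℕ) (r : ℕ → ℝ) (p q : ℕ × ℕ × ZMod 3) : ℝ :=
  if p = q then 1
  else if q.2.2 = p.2.2 + 1 ∧ Compat H n p.1 q.2.1 q.1 then r q.2.1
  else if p.2.2 = q.2.2 + 1 ∧ Compat H n q.1 p.2.1 p.1 then r p.2.1
  else 0

theorem zmod3_aux : ∀ a b : ZMod 3, a = b + 1 → b = a + 1 → False := by decide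

theorem zmod3_aux' : ∀ a : ZMod 3, a ≠ a + 1 := by decide

/-- A good set of types yields a countermodel. -/
theorem model_of_good {Pm : MBParams} (hQ : ∀ α ∈ Pm.J, ∃ q : ℚ, (q : ℝ) = α)
    (K : ℕ) (r : ℕ → ℝ) (hK : 0 < K) (hr0 : r 0 = 0) (hrK : r K = 1)
    (hr : ∀ c < K, r c ∈ Set.Ico (0:ℝ) 1) (A : MBPForm Pm) (T : ℕ)
    (hG : Good K (fun t e c => c ≤ K ∧ HR Pm.J t e (r c)) (encPForm A) T) : ¬ MBPValid A := by
  classical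
  intro hval
  set n := encPForm A with hn
  set H : ℕ → ℕ → ℕ → Prop := fun t e c => c ≤ K ∧ HR Pm.J t e (r c) with hH
  obtain ⟨⟨x0, hx0, hx0T, hx0n⟩, hloc⟩ := hG
  let S : Type := {p : ℕ × ℕ × ZMod 3 // p.1 < 2 ^ (n + 1) ∧ T.testBit p.1 = true ∧ p.2.1 < K}
  let R : S → S → ℝ := fun p q => Rm H n r p.1 q.1
  have hH0 : ∀ t e, ¬ H t e 0 := by
    rintro t e ⟨_, (⟨_, α, _, h0, _, h⟩ | ⟨_, α, hα, _, h⟩)⟩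
    · rw [hr0] at h; linarith
    · rw [hr0] at h; have := (Pm.subI hα).1; linarith
  have hR1 : ∀ p q : S, (p = q ∧ R p q = 1) ∨
      (p ≠ q ∧ ∃ c < K, Compat H n p.1.1 c q.1.1 ∧ R p q = r c) := by
    intro p q
    by_cases hpq : p = q
    · exact Or.inl ⟨hpq, by simp [R, Rm, hpq]⟩
    · refine Or.inr ⟨hpq, ?_⟩
      have hpq' : ¬ p.1 = q.1 := fun h => hpq (Subtype.ext h)
      by_cases h1 : q.1.2.2 = p.1.2.2 + 1 ∧ Compat H n p.1.1 q.1.2.1 q.1.1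
      · exact ⟨q.1.2.1, q.2.2.2, h1.2, by simp only [R, Rm, if_neg hpq', if_pos h1]⟩
      · by_cases h2 : p.1.2.2 = q.1.2.2 + 1 ∧ Compat H n q.1.1 p.1.2.1 p.1.1
        · exact ⟨p.1.2.1, p.2.2.2, h2.2.symm, by
            simp only [R, Rm, if_neg hpq', if_neg h1, if_pos h2]⟩
        · exact ⟨0, hK, fun i _ hh => (hH0 _ _ hh).elim, by
            simp only [R, Rm, if_neg hpq', if_neg h1, if_neg h2, hr0]⟩
  have hR2 : ∀ (p : S) (c y : ℕ), c < K → y < 2 ^ (n + 1) → T.testBit y = true →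
      Compat H n p.1.1 c y → ∃ q : S, q.1.1 = y ∧ R p q = r c := by
    intro p c y hc hy hyT hcomp
    refine ⟨⟨(y, c, p.1.2.2 + 1), hy, hyT, hc⟩, rfl, ?_⟩
    have hne : ¬ p.1 = (y, c, p.1.2.2 + 1) := by
      intro h
      exact zmod3_aux' p.1.2.2 (congrArg (fun z : ℕ × ℕ × ZMod 3 => z.2.2) h)
    simp only [R, Rm, if_neg hne]
    rw [if_pos ⟨trivial, hcomp⟩]
  let F : EQLFrame :=
    { S := S
      nonempty := ⟨⟨(x0, 0, 0), hx0, hx0T, hK⟩⟩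
      R := R
      mem_Icc := by
        intro s t
        rcases hR1 s t with ⟨_, h⟩ | ⟨_, c, hc, _, h⟩
        · rw [h]; simp
        · rw [h]; exact ⟨(hr c hc).1, (hr c hc).2.le⟩
      eq_one_iff := by
        intro s t
        rcases hR1 s t with ⟨h', h⟩ | ⟨h', c, hc, _, h⟩
        · exact ⟨fun _ => h', fun _ => h⟩
        · rw [h]
          exact ⟨fun h1 => absurd h1 (hr c hc).2.ne, fun h1 => absurd h1 h'⟩
      symm := by
        intro p q
        by_cases hpq : p.1 = q.1
        · simp [R, Rm, hpq]
        · have hqp : ¬ q.1 = p.1 := fun h => hpq h.symm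
          simp only [R, Rm, if_neg hpq, if_neg hqp]
          by_cases h1 : q.1.2.2 = p.1.2.2 + 1 ∧ Compat H n p.1.1 q.1.2.1 q.1.1
          · have h2 : ¬ (p.1.2.2 = q.1.2.2 + 1 ∧ Compat H n q.1.1 p.1.2.1 p.1.1) :=
              fun h => zmod3_aux _ _ h.1 h1.1
            rw [if_pos h1, if_neg h2, if_pos h1]
          · rw [if_neg h1, if_neg h1] }
  let V : ℕ → Set S := fun k => {s | s.1.1.testBit (Nat.pair 0 k) = true}
  have hbox : ∀ t e a, (t = 5 ∨ t = 6) → Nat.pair t (Nat.pair e a) < n + 1 → ∀ s : S,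
      ((∀ u : S, HR Pm.J t e (R s u) → u.1.1.testBit a = true) ↔
        s.1.1.testBit (Nat.pair t (Nat.pair e a)) = true) := by
    intro t e a ht hi s
    have hl := (hloc s.1.1 s.2.1 s.2.2.1 _ hi).2.2.2.2.1
    simp only [Nat.unpair_pair] at hl
    obtain ⟨hl1, hl2⟩ := hl ht
    constructor
    · intro hall
      by_contra hb
      rcases hl1 hb with ⟨c, hc, hHc, y, hy, hyT, hya, hcomp⟩ | ⟨hHK, hb'⟩
      · obtain ⟨q, hq, hRq⟩ := hR2 s c y hc hy hyT hcomp
        refine hya ?_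
        rw [← hq]
        exact hall q (by rw [hRq]; exact hHc.2)
      · refine hb' (hall s ?_)
        rcases hR1 s s with ⟨_, h⟩ | ⟨h, _⟩
        · rw [h, ← hrK]; exact hHK.2
        · exact absurd rfl h
    · intro hb u hu
      rcases hR1 s u with ⟨h', h⟩ | ⟨_, c, hc, hcomp, h⟩
      · subst h'
        refine hl2 hb ⟨le_rfl, ?_⟩
        rw [hrK, ← h]; exact hu
      · rw [h] at hu
        have := (hcomp _ hi (by simpa only [Nat.unpair_pair] using ⟨hc.le, hu⟩)).1 hb
        simpa only [Nat.unpair_pair] using this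
  have htruth : ∀ B : MBPForm Pm, encPForm B < n + 1 → ∀ s : S,
      (s ∈ B.valR R V ↔ s.1.1.testBit (encPForm B) = true) := by
    intro B
    induction B with
    | var k => intro _ s; simp [MBPForm.valR, V, encPForm]
    | top =>
      intro hB s
      have hl := (hloc s.1.1 s.2.1 s.2.2.1 _ hB).1
      simp only [encPForm, Nat.unpair_pair] at hl ⊢
      simp [MBPForm.valR, hl]
    | bot =>
      intro hB s
      have hl := (hloc s.1.1 s.2.1 s.2.2.1 _ hB).2.1
      simp only [encPForm, Nat.unpair_pair] at hl ⊢
      simpa [MBPForm.valR] using hl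
    | neg B ih =>
      intro hB s
      have hl := (hloc s.1.1 s.2.1 s.2.2.1 _ hB).2.2.1
      have hB' : encPForm B < n + 1 := lt_of_le_of_lt (Nat.right_le_pair _ _) hB
      simp only [encPForm, Nat.unpair_pair] at hl ⊢
      rw [hl trivial, ← ih hB' s]
      rfl
    | conj B C ihB ihC =>
      intro hB s
      have hl := (hloc s.1.1 s.2.1 s.2.2.1 _ hB).2.2.2.1
      have hp : Nat.pair (encPForm B) (encPForm C) < n + 1 :=
        lt_of_le_of_lt (Nat.right_le_pair _ _) hB
      have hB' : encPForm B < n + 1 := lt_of_le_of_lt (Nat.left_le_pair _ _) hp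
      have hC' : encPForm C < n + 1 := lt_of_le_of_lt (Nat.right_le_pair _ _) hp
      simp only [encPForm, Nat.unpair_pair] at hl ⊢
      rw [hl trivial, ← ihB hB' s, ← ihC hC' s]
      rfl
    | boxe α h h0 B ih =>
      intro hB s
      have hB' : encPForm B < n + 1 := lt_of_le_of_lt (Nat.right_le_pair _ _)
        (lt_of_le_of_lt (Nat.right_le_pair _ _) hB)
      have := hbox 5 (encR α) (encPForm B) (Or.inl rfl) hB s
      simp only [encPForm]
      rw [← this]
      simp only [HR5 hQ h h0, ← ih hB']
      rfl
    | boxo α h B ih =>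
      intro hB s
      have hB' : encPForm B < n + 1 := lt_of_le_of_lt (Nat.right_le_pair _ _)
        (lt_of_le_of_lt (Nat.right_le_pair _ _) hB)
      have := hbox 6 (encR α) (encPForm B) (Or.inr rfl) hB s
      simp only [encPForm]
      rw [← this]
      simp only [HR6 hQ h, ← ih hB']
      rfl
    | boxc0 B ih =>
      intro hB s
      have hl := (hloc s.1.1 s.2.1 s.2.2.1 _ hB).2.2.2.2.2
      have hB' : encPForm B < n + 1 := lt_of_le_of_lt (Nat.right_le_pair _ _) hB
      simp only [encPForm, Nat.unpair_pair] at hl ⊢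
      rw [hl trivial]
      constructor
      · intro hall y hy hyT
        exact (ih hB' ⟨(y, 0, 0), hy, hyT, hK⟩).1 (hall _)
      · intro hall u
        exact (ih hB' u).2 (hall _ u.2.1 u.2.2.1)
  let M : MBPRealization Pm :=
    { F := F
      P := Set.univ
      univ_mem := trivial
      empty_mem := trivial
      inter_mem := fun _ _ _ _ => trivial
      compl_mem := fun _ _ => trivial
      boxe_mem := fun _ _ _ _ _ => trivial
      boxo_mem := fun _ _ _ _ => trivial
      boxc0_mem := fun _ _ => trivial
      V := V
      V_mem := fun _ => trivial }
  have h1 : (⟨(x0, 0, 0), hx0, hx0T, hK⟩ : S) ∈ A.valR R V := hval M ⟨(x0, 0, 0), hx0, hx0T, hK⟩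
  exact hx0n ((htruth A (Nat.lt_succ_self _) _).1 h1)

end helpers

/-- Decidability of the validity problem of MB+ (for `J`
consisting of rational numbers): there is a computable function deciding,
given (the code of) an MB+-formula `A`, whether `A` is valid. -/
theorem decidability_MBplus {Pm : MBParams}
    (hQ : ∀ α ∈ Pm.J, ∃ q : ℚ, (q : ℝ) = α) :
    ∃ f : ℕ → Bool, Computable f ∧
      ∀ A : MBPForm Pm, (MBPValid A ↔ f (encPForm A) = true) := by
  classical
  obtain ⟨K, r, hK, hr0, hrK, hr, hcov⟩ := exists_colors Pm
  have hH : PrimrecPred fun p : ℕ × ℕ × ℕ => p.2.2 ≤ K ∧ HR Pm.J p.1 p.2.1 (r p.2.2) := by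
    refine finP (s := {p : ℕ × ℕ × ℕ | p.2.2 ≤ K ∧ HR Pm.J p.1 p.2.1 (r p.2.2)}) ?_
    refine (((Set.finite_Iic 6).prod ((Pm.finite.image encR).prod (Set.finite_Iic K)))).subset ?_
    rintro ⟨t, e, c⟩ ⟨hc, (⟨ht, α, hα, _, he, _⟩ | ⟨ht, α, hα, he, _⟩)⟩
    · exact ⟨by simp at ht; simp [ht], ⟨α, hα, he⟩, hc⟩
    · exact ⟨by simp at ht; simp [ht], ⟨α, hα, he⟩, hc⟩
  have hS := searchP (H := fun t e c => c ≤ K ∧ HR Pm.J t e (r c)) hH K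
  refine ⟨fun n => decide _, hS.decide.to_comp, fun A => ?_⟩
  rw [decide_eq_true_iff]
  constructor
  · rintro hv ⟨T, _, hT⟩
    exact model_of_good hQ K r hK hr0 hrK hr A T hT hv
  · intro hno M s
    by_contra hs
    refine hno (good_of_model K r hrK hcov M.F M.V (encPForm A) s ?_)
    rw [tr_enc hQ]
    exact hs

end MBQL
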